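/- Fix an integer ℓ > 2. A partition is an (ℓ,0)-JM partition if and only if it is a generalized ℓ-partition. -/

import Mathlib

noncomputable section

/-!
Common combinatorial definitions: partitions (English notation, rows indexed from 1),
Young diagrams, hooks, rim hooks, ladders, residues, crystal operators (classical and
ladder versions), locked boxes, regularization classes, dominance order.
-/

structure YPartition where
  part : ℕ → ℕ
  zero_at_zero : part 0 = 0
  antitone : ∀ i j : ℕ, 1 ≤ i → i ≤ j → part j ≤ part i
  eventually_zero : ∃ N : ℕ, ∀ i : ℕ, N ≤ i → part i = 0

namespace YPartition

/-- The set of boxes of the Young diagram of `μ` (row, column), both indices ≥ 1. -/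
def cells (μ : YPartition) : Set (ℕ × ℕ) :=
  {p | 1 ≤ p.1 ∧ 1 ≤ p.2 ∧ p.2 ≤ μ.part p.1}

/-- The length of column `b`: the number of rows containing a box in column `b`. -/
def colLen (μ : YPartition) (b : ℕ) : ℕ :=
  Nat.card {a : ℕ | 1 ≤ a ∧ b ≤ μ.part a}

/-- The arm of box `(a,b)`: boxes strictly to its right in its row. -/
def arm (μ : YPartition) (a b : ℕ) : ℕ := μ.part a - b

/-- The leg of box `(a,b)`: boxes strictly below it in its column. -/
def leg (μ : YPartition) (a b : ℕ) : ℕ := μ.colLen b - a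

/-- The hook length of the box `(a,b)`: arm + leg + 1. -/
def hook (μ : YPartition) (a b : ℕ) : ℕ := (μ.part a - b) + (μ.colLen b - a) + 1

/-- The number of boxes of `μ`. -/
def size (μ : YPartition) : ℕ := μ.cells.ncard

/-- The number of (nonzero) parts of `μ`. -/
def length (μ : YPartition) : ℕ := μ.colLen 1

/-- `μ` is an `(ℓ,0)`-JM partition: there are no boxes `(a,b)`, `(a,y)`, `(x,b)` with
`ℓ ∣ hook (a,b)` while `ℓ` divides neither `hook (a,y)` nor `hook (x,b)`. -/
def IsJM (ℓ : ℕ) (μ : YPartition) : Prop :=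
  ¬ ∃ a b y x : ℕ, (a, b) ∈ μ.cells ∧ (a, y) ∈ μ.cells ∧ (x, b) ∈ μ.cells ∧
    ℓ ∣ μ.hook a b ∧ ¬ ℓ ∣ μ.hook a y ∧ ¬ ℓ ∣ μ.hook x b

/-- Two boxes share an edge. -/
def BoxAdjacent (p q : ℕ × ℕ) : Prop :=
  (p.1 = q.1 ∧ (p.2 + 1 = q.2 ∨ q.2 + 1 = p.2)) ∨
  (p.2 = q.2 ∧ (p.1 + 1 = q.1 ∨ q.1 + 1 = p.1))

/-- A set of boxes is connected (via shared edges, inside the set). -/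
def SetConnected (S : Set (ℕ × ℕ)) : Prop :=
  ∀ p ∈ S, ∀ q ∈ S,
    Relation.ReflTransGen (fun x y => x ∈ S ∧ y ∈ S ∧ BoxAdjacent x y) p q

/-- `S` contains no 2 × 2 square of boxes. -/
def HasNoSquare (S : Set (ℕ × ℕ)) : Prop :=
  ¬ ∃ a b : ℕ, (a, b) ∈ S ∧ (a + 1, b) ∈ S ∧ (a, b + 1) ∈ S ∧ (a + 1, b + 1) ∈ S

/-- `S` is a removable `ℓ`-rim hook of `μ`: a connected set of `ℓ` boxes of `μ` with no
2 × 2 square whose removal leaves the Young diagram of a partition. -/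
def IsRimHook (ℓ : ℕ) (μ : YPartition) (S : Set (ℕ × ℕ)) : Prop :=
  S ⊆ μ.cells ∧ S.ncard = ℓ ∧ SetConnected S ∧ HasNoSquare S ∧
    ∃ ν : YPartition, ν.cells = μ.cells \ S

/-- `S` is contained in a single row. -/
def HorizontalHook (S : Set (ℕ × ℕ)) : Prop := ∃ a : ℕ, ∀ p ∈ S, p.1 = a

/-- `S` is contained in a single column. -/
def VerticalHook (S : Set (ℕ × ℕ)) : Prop := ∃ b : ℕ, ∀ p ∈ S, p.2 = b

/-- Two sets of boxes are adjacent when some box of one shares an edge with a box of the other. -/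
def SetsAdjacent (R S : Set (ℕ × ℕ)) : Prop := ∃ p ∈ R, ∃ q ∈ S, BoxAdjacent p q

/-- An `ℓ`-core: a partition with no removable `ℓ`-rim hook. -/
def IsCore (ℓ : ℕ) (μ : YPartition) : Prop := ¬ ∃ S : Set (ℕ × ℕ), IsRimHook ℓ μ S

/-- `p` and `q` lie on the same ladder: going down one column step the row increases
by `ℓ - 1`. -/
def SameLadder (ℓ : ℕ) (p q : ℕ × ℕ) : Prop :=
  (q.1 : ℤ) - (p.1 : ℤ) = ((ℓ : ℤ) - 1) * ((p.2 : ℤ) - (q.2 : ℤ))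

/-- The index of the ladder through `p`: the ladder through `(k,1)` has index `k`. -/
def ladderIdx (ℓ : ℕ) (p : ℕ × ℕ) : ℕ := p.1 + (ℓ - 1) * (p.2 - 1)

/-- The residue of position `(a,b)` is `b - a` mod `ℓ`. -/
def res (ℓ : ℕ) (p : ℕ × ℕ) : ℕ := (((p.2 : ℤ) - (p.1 : ℤ)) % (ℓ : ℤ)).toNat

/-- `p` is a removable box of `μ`. -/
def Removable (μ : YPartition) (p : ℕ × ℕ) : Prop :=
  1 ≤ p.1 ∧ p.2 = μ.part p.1 ∧ μ.part (p.1 + 1) < p.2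

/-- `p` is an addable box of `μ`. -/
def Addable (μ : YPartition) (p : ℕ × ℕ) : Prop :=
  1 ≤ p.1 ∧ p.2 = μ.part p.1 + 1 ∧ (p.1 = 1 ∨ p.2 ≤ μ.part (p.1 - 1))

/-- The removable `i`-boxes of `μ`. -/
def RemovableRes (ℓ i : ℕ) (μ : YPartition) : Set (ℕ × ℕ) :=
  {p | Removable μ p ∧ res ℓ p = i}

/-- The addable `i`-boxes of `μ`. -/
def AddableRes (ℓ i : ℕ) (μ : YPartition) : Set (ℕ × ℕ) :=
  {p | Addable μ p ∧ res ℓ p = i}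

/-- Ladder reading order (reflexive): ladders left to right, top to bottom within a ladder.
`LadderLE ℓ p q` means `p` is read before (or equal to) `q`. -/
def LadderLE (ℓ : ℕ) (p q : ℕ × ℕ) : Prop :=
  ladderIdx ℓ p < ladderIdx ℓ q ∨ (ladderIdx ℓ p = ladderIdx ℓ q ∧ p.1 ≤ q.1)

/-- Strict ladder reading order. -/
def LadderLT (ℓ : ℕ) (p q : ℕ × ℕ) : Prop :=
  ladderIdx ℓ p < ladderIdx ℓ q ∨ (ladderIdx ℓ p = ladderIdx ℓ q ∧ p.1 < q.1)

/-- Classical reading order (reflexive): rows from bottom to top.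
`RowLE p q` means `p` is read before (or equal to) `q`. -/
def RowLE (p q : ℕ × ℕ) : Prop := q.1 ≤ p.1

/-- Given a reading order `le`, a set `Rem` of `-` marks and `Add` of `+` marks, a `-` at `p`
survives the cancellation of adjacent `-+` pairs iff every interval of the reading word
starting at `p` contains strictly more `-`'s than `+`'s. -/
def NormalIn (le : ℕ × ℕ → ℕ × ℕ → Prop) (Rem Add : Set (ℕ × ℕ)) (p : ℕ × ℕ) : Prop :=
  p ∈ Rem ∧ ∀ q ∈ Rem ∪ Add, le p q →
    (Add ∩ {s | le p s ∧ le s q}).ncard < (Rem ∩ {s | le p s ∧ le s q}).ncard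

/-- A `+` at `q` survives the cancellation of adjacent `-+` pairs iff every interval of the
reading word ending at `q` contains strictly more `+`'s than `-`'s. -/
def ConormalIn (le : ℕ × ℕ → ℕ × ℕ → Prop) (Rem Add : Set (ℕ × ℕ)) (q : ℕ × ℕ) : Prop :=
  q ∈ Add ∧ ∀ p ∈ Rem ∪ Add, le p q →
    (Rem ∩ {s | le p s ∧ le s q}).ncard < (Add ∩ {s | le p s ∧ le s q}).ncard

/-- Ladder normal `i`-box. -/
def LadderNormal (ℓ i : ℕ) (μ : YPartition) (p : ℕ × ℕ) : Prop :=
  NormalIn (LadderLE ℓ) (RemovableRes ℓ i μ) (AddableRes ℓ i μ) p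

/-- Ladder conormal `i`-box. -/
def LadderConormal (ℓ i : ℕ) (μ : YPartition) (p : ℕ × ℕ) : Prop :=
  ConormalIn (LadderLE ℓ) (RemovableRes ℓ i μ) (AddableRes ℓ i μ) p

/-- Normal `i`-box (classical signature). -/
def ClassNormal (ℓ i : ℕ) (μ : YPartition) (p : ℕ × ℕ) : Prop :=
  NormalIn RowLE (RemovableRes ℓ i μ) (AddableRes ℓ i μ) p

/-- Conormal `i`-box (classical signature). -/
def ClassConormal (ℓ i : ℕ) (μ : YPartition) (p : ℕ × ℕ) : Prop :=
  ConormalIn RowLE (RemovableRes ℓ i μ) (AddableRes ℓ i μ) p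

/-- `ε̂_i(μ)`: number of ladder normal `i`-boxes. -/
def hatEps (ℓ i : ℕ) (μ : YPartition) : ℕ := {p | LadderNormal ℓ i μ p}.ncard

/-- `φ̂_i(μ)`: number of ladder conormal `i`-boxes. -/
def hatPhi (ℓ i : ℕ) (μ : YPartition) : ℕ := {p | LadderConormal ℓ i μ p}.ncard

/-- `ε_i(μ)`: number of normal `i`-boxes. -/
def eps (ℓ i : ℕ) (μ : YPartition) : ℕ := {p | ClassNormal ℓ i μ p}.ncard

/-- `φ_i(μ)`: number of conormal `i`-boxes. -/
def phi (ℓ i : ℕ) (μ : YPartition) : ℕ := {p | ClassConormal ℓ i μ p}.ncard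

/-- The ladder good `i`-box: the leftmost `-` of the reduced ladder `i`-signature. -/
def LadderGood (ℓ i : ℕ) (μ : YPartition) (p : ℕ × ℕ) : Prop :=
  LadderNormal ℓ i μ p ∧ ∀ q, LadderNormal ℓ i μ q → LadderLE ℓ p q

/-- The ladder cogood `i`-box: the rightmost `+` of the reduced ladder `i`-signature. -/
def LadderCogood (ℓ i : ℕ) (μ : YPartition) (p : ℕ × ℕ) : Prop :=
  LadderConormal ℓ i μ p ∧ ∀ q, LadderConormal ℓ i μ q → LadderLE ℓ q p

/-- The good `i`-box (classical). -/
def ClassGood (ℓ i : ℕ) (μ : YPartition) (p : ℕ × ℕ) : Prop :=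
  ClassNormal ℓ i μ p ∧ ∀ q, ClassNormal ℓ i μ q → RowLE p q

/-- The cogood `i`-box (classical). -/
def ClassCogood (ℓ i : ℕ) (μ : YPartition) (p : ℕ × ℕ) : Prop :=
  ClassConormal ℓ i μ p ∧ ∀ q, ClassConormal ℓ i μ q → RowLE q p

/-- The ladder crystal operator `f̂_i` as a relation: `mu = f̂_i lam ≠ 0`. -/
def HatF (ℓ i : ℕ) (lam mu : YPartition) : Prop :=
  ∃ p, LadderCogood ℓ i lam p ∧ mu.cells = insert p lam.cells

/-- The ladder crystal operator `ê_i` as a relation: `mu = ê_i lam ≠ 0`. -/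
def HatE (ℓ i : ℕ) (lam mu : YPartition) : Prop :=
  ∃ p, LadderGood ℓ i lam p ∧ mu.cells = lam.cells \ {p}

/-- The classical crystal operator `f̃_i` as a relation: `mu = f̃_i lam ≠ 0`. -/
def TildeF (ℓ i : ℕ) (lam mu : YPartition) : Prop :=
  ∃ p, ClassCogood ℓ i lam p ∧ mu.cells = insert p lam.cells

/-- The classical crystal operator `ẽ_i` as a relation: `mu = ẽ_i lam ≠ 0`. -/
def TildeE (ℓ i : ℕ) (lam mu : YPartition) : Prop :=
  ∃ p, ClassGood ℓ i lam p ∧ mu.cells = lam.cells \ {p}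

/-- `n`-fold composition of a relation. -/
def RelIter {α : Type} (r : α → α → Prop) : ℕ → α → α → Prop
  | 0 => fun a b => a = b
  | n + 1 => fun a b => ∃ c, r a c ∧ RelIter r n c b

/-- The empty partition. -/
def emptyP : YPartition where
  part := fun _ => 0
  zero_at_zero := rfl
  antitone := fun _ _ _ _ => le_rfl
  eventually_zero := ⟨0, fun _ _ => rfl⟩

/-- `μ` is a node of the ladder crystal `B(Λ₀)^L`: it is obtained from the empty
partition by finitely many applications of the operators `f̂_i`, `0 ≤ i < ℓ`. -/
def LadderNode (ℓ : ℕ) (μ : YPartition) : Prop :=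
  Relation.ReflTransGen (fun a b => ∃ i : ℕ, i < ℓ ∧ HatF ℓ i a b) emptyP μ

/-- The type I locking condition at `(a,b)`: every unoccupied position on the ladder of
`(a,b)` lying below it has an unoccupied position directly above it. -/
def LadderClear (ℓ : ℕ) (μ : YPartition) (a b : ℕ) : Prop :=
  ∀ c d : ℕ, 1 ≤ c → 1 ≤ d → SameLadder ℓ (a, b) (c, d) → a < c →
    (c, d) ∉ μ.cells → (c - 1, d) ∉ μ.cells

/-- Locked boxes of `μ`. -/
inductive Locked (ℓ : ℕ) (μ : YPartition) : ℕ × ℕ → Prop where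
  | typeI_top : ∀ b : ℕ, (1, b) ∈ μ.cells → LadderClear ℓ μ 1 b → Locked ℓ μ (1, b)
  | typeI_up : ∀ a b : ℕ, (a + 1, b) ∈ μ.cells → Locked ℓ μ (a, b) →
      LadderClear ℓ μ (a + 1) b → Locked ℓ μ (a + 1, b)
  | typeII : ∀ a b b' : ℕ, (a, b) ∈ μ.cells → b < b' → Locked ℓ μ (a, b') → Locked ℓ μ (a, b)

/-- Number of boxes of `μ` on the `k`-th ladder. -/
def ladderCount (ℓ : ℕ) (μ : YPartition) (k : ℕ) : ℕ :=
  (μ.cells ∩ {p | ladderIdx ℓ p = k}).ncard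

/-- `lam` and `mu` lie in the same regularization class: they have the same number of
boxes on every ladder. -/
def SameRegClass (ℓ : ℕ) (lam mu : YPartition) : Prop :=
  ∀ k : ℕ, ladderCount ℓ lam k = ladderCount ℓ mu k

/-- The boxes of `μ` are top-justified on each ladder. -/
def TopJustified (ℓ : ℕ) (μ : YPartition) : Prop :=
  ∀ p ∈ μ.cells, ∀ q : ℕ × ℕ, 1 ≤ q.1 → 1 ≤ q.2 →
    ladderIdx ℓ q = ladderIdx ℓ p → q.1 < p.1 → q ∈ μ.cells

/-- `mu = R lam`: the regularization of `lam`, obtained by moving every box of `lam` to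
the topmost unoccupied positions of its ladder. -/
def IsRegularization (ℓ : ℕ) (lam mu : YPartition) : Prop :=
  SameRegClass ℓ lam mu ∧ TopJustified ℓ mu

/-- Dominance order on partitions. -/
def DomLE (lam mu : YPartition) : Prop :=
  ∀ j : ℕ, ∑ i ∈ Finset.Icc 1 j, lam.part i ≤ ∑ i ∈ Finset.Icc 1 j, mu.part i

/-- All (positive) positions on the `k`-th ladder. -/
def LadderPositions (ℓ k : ℕ) : Set (ℕ × ℕ) :=
  {p | 1 ≤ p.1 ∧ 1 ≤ p.2 ∧ ladderIdx ℓ p = k}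

/-- The set of locked boxes of `μ`. -/
def lockedCells (ℓ : ℕ) (μ : YPartition) : Set (ℕ × ℕ) := {p | Locked ℓ μ p}

/-- The number of unlocked boxes of `μ` on the `k`-th ladder. -/
def unlockedCount (ℓ : ℕ) (μ : YPartition) (k : ℕ) : ℕ :=
  ((μ.cells ∩ LadderPositions ℓ k) \ lockedCells ℓ μ).ncard

/-- The diagram `S μ`: locked boxes stay put, and on each ladder the unlocked boxes are
moved into the lowest positions of that ladder not occupied by locked boxes. -/
def SCells (ℓ : ℕ) (μ : YPartition) : Set (ℕ × ℕ) :=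
  lockedCells ℓ μ ∪
    {p | 1 ≤ p.1 ∧ 1 ≤ p.2 ∧ p ∉ lockedCells ℓ μ ∧
      ((LadderPositions ℓ (ladderIdx ℓ p) ∩ {q | p.1 < q.1}) \ lockedCells ℓ μ).ncard
        < unlockedCount ℓ μ (ladderIdx ℓ p)}

/-- `μ` is `ℓ`-regular: no part occurs `ℓ` or more times. -/
def IsRegular (ℓ : ℕ) (μ : YPartition) : Prop :=
  ∀ a : ℕ, 1 ≤ a → 0 < μ.part (a + (ℓ - 1)) → μ.part (a + (ℓ - 1)) < μ.part a

/-- Removal of a single horizontal or vertical `ℓ`-rim hook. -/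
def RemoveHV (ℓ : ℕ) (lam mu : YPartition) : Prop :=
  ∃ S : Set (ℕ × ℕ), IsRimHook ℓ lam S ∧ (HorizontalHook S ∨ VerticalHook S) ∧
    mu.cells = lam.cells \ S

/-- Condition (1): every removable `ℓ`-rim hook is horizontal or vertical. -/
def Cond1 (ℓ : ℕ) (μ : YPartition) : Prop :=
  ∀ S : Set (ℕ × ℕ), IsRimHook ℓ μ S → HorizontalHook S ∨ VerticalHook S

/-- Condition (2): no vertical (resp. horizontal) `ℓ`-rim hook `R` of `μ` together with an
adjacent horizontal (resp. vertical) `ℓ`-rim hook `S` of `μ \ R` . -/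
def Cond2 (ℓ : ℕ) (μ : YPartition) : Prop :=
  ¬ ∃ (R S : Set (ℕ × ℕ)) (ν : YPartition), IsRimHook ℓ μ R ∧ ν.cells = μ.cells \ R ∧
    IsRimHook ℓ ν S ∧ SetsAdjacent R S ∧
    ((VerticalHook R ∧ HorizontalHook S) ∨ (HorizontalHook R ∧ VerticalHook S))

/-- A generalized `ℓ`-partition: conditions (1) and (2) hold after removing any sequence of
horizontal and vertical `ℓ`-rim hooks (including the empty sequence). -/
def IsGenLPartition (ℓ : ℕ) (lam : YPartition) : Prop :=
  ∀ mu : YPartition, Relation.ReflTransGen (RemoveHV ℓ) lam mu → Cond1 ℓ mu ∧ Cond2 ℓ mu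

/-- The `t`-th row (from the top) of the bottom block of the decomposition
`(μ, r, s, ρ, σ)`: the number of values `v ∈ [1, s+1]` whose column block still reaches
row `t`; column block `v` consists of `σ_v·ℓ + (s+1−v)(ℓ−1)` rows of length `≥ v`. -/
def bottomPart (ℓ s : ℕ) (σ : YPartition) (t : ℕ) : ℕ :=
  ((Finset.Icc 1 (s + 1)).filter fun v => t ≤ σ.part v * ℓ + (s + 1 - v) * (ℓ - 1)).card

/-- The `i`-th part of the partition corresponding to the data `(μ, r, s, ρ, σ)`. -/
def decompPart (ℓ : ℕ) (mu : YPartition) (r s : ℕ) (ρ σ : YPartition) (i : ℕ) : ℕ :=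
  if i = 0 then 0
  else if i ≤ r + 1 then s + mu.part 1 + (r + 1 - i) * (ℓ - 1) + ρ.part i * ℓ
  else if i ≤ r + max mu.length 1 then s + mu.part (i - r)
  else bottomPart ℓ s σ (i - (r + max mu.length 1))

/-- Admissibility of the decomposition data `(μ, r, s, ρ, σ)`. -/
def GoodData (ℓ : ℕ) (mu : YPartition) (r s : ℕ) (ρ σ : YPartition) : Prop :=
  IsCore ℓ mu ∧ mu.part 1 < mu.part 2 + (ℓ - 1) ∧ mu.colLen 1 < mu.colLen 2 + (ℓ - 1) ∧
  ρ.length ≤ r + 1 ∧ σ.length ≤ s + 1 ∧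
  (mu.cells = ∅ → ρ.part (r + 1) = 0 ∨ σ.part (s + 1) = 0)

/-- `lam ≈ (μ, r, s, ρ, σ)`. -/
def Decomposes (ℓ : ℕ) (lam mu : YPartition) (r s : ℕ) (ρ σ : YPartition) : Prop :=
  ∀ i : ℕ, lam.part i = decompPart ℓ mu r s ρ σ i

/-- Removal of a single `ℓ`-rim hook. -/
def RemoveHook (ℓ : ℕ) (lam mu : YPartition) : Prop :=
  ∃ S : Set (ℕ × ℕ), IsRimHook ℓ lam S ∧ mu.cells = lam.cells \ S

/-- `lam` has `ℓ`-core `nu` and `ℓ`-weight `w`. -/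
def HasCoreAndWeight (ℓ : ℕ) (lam nu : YPartition) (w : ℕ) : Prop :=
  IsCore ℓ nu ∧ RelIter (RemoveHook ℓ) w lam nu

/-- An L-partition. -/
def IsLPartition (ℓ : ℕ) (lam : YPartition) : Prop :=
  ¬ ∃ p : ℕ × ℕ, p ∈ lam.cells ∧ ℓ ∣ lam.hook p.1 p.2 ∧
    (lam.arm p.1 p.2 < (ℓ - 1) * lam.leg p.1 p.2 ∨
     lam.leg p.1 p.2 < (ℓ - 1) * lam.arm p.1 p.2)

end YPartition

/-! ### Abstract bead (Maya diagram) combinatorics -/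

namespace Maya

/-- Horizontal move: bead at `x`, gaps at `x-ℓ, …, x-1`. -/
def Hor (ℓ : ℤ) (X : ℤ → Prop) (x : ℤ) : Prop :=
  X x ∧ ¬ X (x - ℓ) ∧ ∀ n, x - ℓ < n → n < x → ¬ X n

/-- Vertical move: bead at `x-ℓ+1, …, x`, gap at `x-ℓ`. -/
def Ver (ℓ : ℤ) (X : ℤ → Prop) (x : ℤ) : Prop :=
  X x ∧ ¬ X (x - ℓ) ∧ ∀ n, x - ℓ < n → n < x → X n

/-- Moving the bead `x` to `x - ℓ`. -/
def mv (ℓ : ℤ) (X : ℤ → Prop) (x : ℤ) : ℤ → Prop :=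
  fun n => (X n ∧ n ≠ x) ∨ n = x - ℓ

def AJM (ℓ : ℤ) (X : ℤ → Prop) : Prop :=
  ∀ z y g b, X z → ¬ X y → y < z → ℓ ∣ z - y → ¬ X g → g < z → ¬ ℓ ∣ z - g →
    X b → y < b → ¬ ℓ ∣ b - y → False

def AC1 (ℓ : ℤ) (X : ℤ → Prop) : Prop :=
  ∀ x, X x → ¬ X (x - ℓ) → Hor ℓ X x ∨ Ver ℓ X x

def PatC (ℓ : ℤ) (X : ℤ → Prop) (x : ℤ) : Prop :=
  Hor ℓ X x ∧ ¬ X (x - ℓ - ℓ) ∧ ∀ n, x - ℓ - ℓ < n → n < x - ℓ → X n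

def PatB (ℓ : ℤ) (X : ℤ → Prop) (x : ℤ) : Prop :=
  Ver ℓ X x ∧ X (x + ℓ) ∧ ∀ n, x < n → n < x + ℓ → ¬ X n

theorem chain (ℓ : ℤ) (hℓ : 0 < ℓ) (X : ℤ → Prop) (y : ℤ) (hy : ¬ X y) :
    ∀ (k : ℕ), X (y + ℓ * k) →
      ∃ w, X w ∧ ¬ X (w - ℓ) ∧ y ≤ w - ℓ ∧ w ≤ y + ℓ * k ∧ ℓ ∣ w - y := by
  intro k
  induction k with
  | zero => intro h; exact absurd (by simpa using h) hy
  | succ k ih =>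
    intro h
    by_cases h' : X (y + ℓ * k)
    · obtain ⟨w, h1, h2, h3, h4, h5⟩ := ih h'
      refine ⟨w, h1, h2, h3, ?_, h5⟩
      push_cast; nlinarith
    · refine ⟨_, h, ?_, ?_, le_rfl, ?_⟩
      · convert h' using 2; push_cast; ring
      · push_cast
        have : 0 ≤ ℓ * k := by positivity
        linarith
      · exact ⟨((k + 1 : ℕ) : ℤ), by ring⟩

theorem chain' (ℓ : ℤ) (hℓ : 0 < ℓ) (X : ℤ → Prop) (y z : ℤ) (hy : ¬ X y) (hz : X z)
    (hyz : y < z) (hd : ℓ ∣ z - y) :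
    ∃ w, X w ∧ ¬ X (w - ℓ) ∧ y ≤ w - ℓ ∧ w ≤ z ∧ ℓ ∣ w - y := by
  obtain ⟨k, hk⟩ := hd
  have hk0 : 0 ≤ k := by
    by_contra h
    push Not at h
    nlinarith
  obtain ⟨m, rfl⟩ := Int.eq_ofNat_of_zero_le hk0
  have hz' : z = y + ℓ * m := by linarith
  subst hz'
  exact chain ℓ hℓ X y hy m hz

theorem not_dvd_small (ℓ i : ℤ) (h1 : 0 < i) (h2 : i < ℓ) : ¬ ℓ ∣ i := fun h => by
  have := Int.le_of_dvd h1 h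
  omega

theorem dvd_gap (ℓ a b : ℤ) (h : ℓ ∣ a - b) (hab : b < a) : b + ℓ ≤ a := by
  have := Int.le_of_dvd (by omega) h
  omega

/-- combine divisibilities -/
theorem dvd_of_sub (ℓ a b c : ℤ) (h : ℓ ∣ a) (h' : ℓ ∣ b) (e : c = a - b) : ℓ ∣ c :=
  e ▸ dvd_sub h h'

theorem dvd_of_add (ℓ a b c : ℤ) (h : ℓ ∣ a) (h' : ℓ ∣ b) (e : c = a + b) : ℓ ∣ c :=
  e ▸ dvd_add h h'

theorem keyH (ℓ : ℤ) (hℓ : 2 < ℓ) (X : ℤ → Prop) (h1 : AC1 ℓ X) (hC : ∀ x, ¬ PatC ℓ X x)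
    (hm : ∀ x, Hor ℓ X x ∨ Ver ℓ X x → AJM ℓ (mv ℓ X x)) (x : ℤ) (hx : Hor ℓ X x) :
    AJM ℓ X := by
  intro z y g b hz hy hyz hdy hg hgz hdg hb hyb hdb
  have J := hm x (Or.inl hx)
  obtain ⟨hx1, hx2, hx3⟩ := hx
  have hll : ℓ ∣ ℓ := dvd_rfl
  by_cases hzx : ℓ ∣ z - x
  · have hgx : g ≠ x - ℓ := by
      rintro rfl
      exact hdg (dvd_of_add ℓ _ _ _ hzx hll (by ring))
    have hgm : ¬ mv ℓ X x g := by
      rintro (h | h)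
      · exact hg h.1
      · exact hgx h
    have hxy : ℓ ∣ x - y := dvd_of_sub ℓ _ _ _ hdy hzx (by ring)
    have hbx : b ≠ x := by
      rintro rfl
      exact hdb hxy
    have hbm : mv ℓ X x b := Or.inl ⟨hb, hbx⟩
    by_cases ezx : z = x
    · subst ezx
      by_cases eyx : y = z - ℓ
      · -- 2c
        subst eyx
        have hbz : z < b := by
          by_contra h
          exact hx3 b hyb (by omega) hb
        have hdb' : ¬ ℓ ∣ b - z := fun h => hdb (dvd_of_add ℓ _ _ _ h hll (by ring))
        obtain ⟨c, ⟨hc1, hc2, hc3⟩, hcmin⟩ := Int.exists_least_of_bdd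
          (P := fun c => X c ∧ z < c ∧ ¬ ℓ ∣ c - z) ⟨z, fun c hc => by omega⟩ ⟨b, hb, hbz, hdb'⟩
        have hcl : ¬ X (c - ℓ) := by
          intro h
          by_cases h' : z < c - ℓ
          · have := hcmin (c - ℓ) ⟨h, h', fun h => hc3 (dvd_of_add ℓ _ _ _ h hll (by ring))⟩
            omega
          · have : c - ℓ ≠ z := by
              intro e
              exact hc3 (by rw [← e]; simp)
            exact hx3 _ (by omega) (by omega) h
        have hcz : c - ℓ ≠ z := by
          intro e
          exact hc3 (by rw [← e]; simp)
        rcases h1 c hc1 hcl with hh | hh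
        · have J' := hm c (Or.inl hh)
          have : z < c - ℓ := by
            by_contra h
            exact hh.2.2 z (by omega) hc2 hx1
          refine J' z (z - ℓ) (z - 1) (c - ℓ) (Or.inl ⟨hx1, by omega⟩) ?_ (by omega) (by simp)
            ?_ (by omega) ?_ (Or.inr rfl) (by omega) ?_
          · rintro (h | h)
            · exact hx2 h.1
            · omega
          · rintro (h | h)
            · exact hx3 _ (by omega) (by omega) h.1
            · omega
          · exact not_dvd_small ℓ _ (by omega) (by omega)
          · intro h
            exact hc3 (dvd_of_add ℓ _ _ _ h (dvd_zero ℓ) (by ring))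
        · obtain ⟨_, _, hv⟩ := hh
          have a1 : z - 1 ≤ c - ℓ := by
            by_contra h
            exact hx3 (z - 1) (by omega) (by omega) (hv (z - 1) (by omega) (by omega))
          have b1 := hv (c - 1) (by omega) (by omega)
          have b2 := hv (c - 2) (by omega) (by omega)
          have d1 : ℓ ∣ c - 1 - z := by
            by_contra h
            have := hcmin (c - 1) ⟨b1, by omega, h⟩
            omega
          by_cases h2 : z < c - 2
          · have d2 : ℓ ∣ c - 2 - z := by
              by_contra h
              have := hcmin (c - 2) ⟨b2, h2, h⟩
              omega
            exact not_dvd_small ℓ 1 (by omega) (by omega) (dvd_of_sub ℓ _ _ _ d1 d2 (by ring))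
          · have : c - 1 - z = 1 := by omega
            rw [this] at d1
            exact not_dvd_small ℓ 1 (by omega) (by omega) d1
      · -- 2b
        have hyl := dvd_gap ℓ z y hdy hyz
        have hyl' : y < z - ℓ := by omega
        have hym : ¬ mv ℓ X z y := by
          rintro (h | h)
          · exact hy h.1
          · exact eyx h
        have hzm : mv ℓ X z (z - ℓ) := Or.inr rfl
        have hdyl : ℓ ∣ z - ℓ - y := dvd_of_sub ℓ _ _ _ hdy hll (by ring)
        have claim : ∀ q, q < z - ℓ → ¬ ℓ ∣ z - q → X q := by
          intro q hq hdq
          by_contra hXq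
          refine J (z - ℓ) y q b hzm hym hyl' hdyl ?_ hq ?_ hbm hyb hdb
          · rintro (h | h)
            · exact hXq h.1
            · omega
          · intro h
            exact hdq (dvd_of_add ℓ _ _ _ h hll (by ring))
        obtain ⟨w, hw1, hw2, hw3, hw4, hw5⟩ := chain' ℓ (by omega) (mv ℓ X z) y (z - ℓ) hym hzm
          hyl' hdyl
        have hzw : ℓ ∣ z - w := dvd_of_sub ℓ _ _ _ hdy hw5 (by ring)
        have hbetw : ∀ n, w - ℓ < n → n < w → X n := by
          intro n hn1 hn2
          apply claim n (by omega)
          intro h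
          have := dvd_of_sub ℓ _ _ (w - n) h hzw (by ring)
          exact not_dvd_small ℓ (w - n) (by omega) (by omega) this
        have hwl : ¬ X (w - ℓ) := by
          intro h
          exact hw2 (Or.inl ⟨h, by omega⟩)
        by_cases ew : w = z - ℓ
        · subst ew
          exact hC z ⟨⟨hx1, hx2, hx3⟩, hwl, hbetw⟩
        · have hXw : X w := by
            rcases hw1 with h | h
            · exact h.1
            · exact absurd h ew
          have J' := hm w (Or.inr ⟨hXw, hwl, hbetw⟩)
          have hgap := dvd_gap ℓ (z - ℓ) w (dvd_of_sub ℓ _ _ _ hzw hll (by ring)) (by omega)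
          refine J' z w (z - 1) (w + 1) (Or.inl ⟨hz, by omega⟩) ?_ (by omega) hzw ?_ (by omega) ?_
            (Or.inl ⟨claim _ (by omega) ?_, by omega⟩) (by omega) ?_
          · rintro (h | h)
            · exact h.2 rfl
            · omega
          · rintro (h | h)
            · exact hx3 _ (by omega) (by omega) h.1
            · omega
          · exact not_dvd_small ℓ _ (by omega) (by omega)
          · intro h
            exact not_dvd_small ℓ 1 (by omega) (by omega) (dvd_of_sub ℓ _ _ _ hzw h (by ring))
          · exact not_dvd_small ℓ _ (by omega) (by omega)
    · by_cases eyx : y = x - ℓ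
      · -- 2d
        subst eyx
        have hzx' : x < z := by
          by_contra h
          exact hx3 z hyz (by omega) hz
        have hbx' : x < b := by
          by_contra h
          exact hx3 b hyb (by omega) hb
        refine J z x g b (Or.inl ⟨hz, ezx⟩) ?_ hzx' hzx hgm hgz hdg hbm hbx' ?_
        · rintro (h | h)
          · exact h.2 rfl
          · omega
        · intro h
          exact hdb (dvd_of_add ℓ _ _ _ h hll (by ring))
      · refine J z y g b (Or.inl ⟨hz, ezx⟩) ?_ hyz hdy hgm hgz hdg hbm hyb hdb
        rintro (h | h)
        · exact hy h.1
        · exact eyx h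
  · -- case 1
    have ezx : z ≠ x := by
      rintro rfl
      exact hzx (by simp)
    have eyx : y ≠ x - ℓ := by
      rintro rfl
      exact hzx (dvd_of_sub ℓ _ _ _ hdy hll (by ring))
    have hym : ¬ mv ℓ X x y := by
      rintro (h | h)
      · exact hy h.1
      · exact eyx h
    have hzm : mv ℓ X x z := Or.inl ⟨hz, ezx⟩
    obtain ⟨g', hg1, hg2, hg3⟩ : ∃ g', ¬ mv ℓ X x g' ∧ g' < z ∧ ¬ ℓ ∣ z - g' := by
      by_cases eg : g = x - ℓ
      · subst eg
        refine ⟨x, ?_, ?_, hzx⟩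
        · rintro (h | h)
          · exact h.2 rfl
          · omega
        · by_contra h
          exact hx3 z hgz (by omega) hz
      · refine ⟨g, ?_, hgz, hdg⟩
        rintro (h | h)
        · exact hg h.1
        · exact eg h
    have J1 : ∀ q, mv ℓ X x q → y < q → ¬ ℓ ∣ q - y → False := fun q h h' h'' =>
      J z y g' q hzm hym hyz hdy hg1 hg2 hg3 h h' h''
    have hbx : b = x := by
      by_contra h
      exact J1 b (Or.inl ⟨hb, h⟩) hyb hdb
    subst hbx
    have hyx : b - ℓ < y := by
      by_contra h
      refine J1 (b - ℓ) (Or.inr rfl) (by omega) ?_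
      intro h
      exact hdb (dvd_of_add ℓ _ _ _ h hll (by ring))
    obtain ⟨w, hw1, hw2, hw3, hw4, hw5⟩ := chain' ℓ (by omega) X y z hy hz hyz hdy
    rcases h1 w hw1 hw2 with hh | hh
    · by_cases ew : w - ℓ = y
      · exact hh.2.2 b (by omega) (by omega) hb
      · have J' := hm w (Or.inl hh)
        have hwl : ℓ ∣ w - ℓ - y := dvd_of_sub ℓ _ _ _ hw5 hll (by ring)
        have hgap := dvd_gap ℓ (w - ℓ) y hwl (by omega)
        have hbw : b ≠ w := by
          rintro rfl
          exact hdb hw5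
        refine J' (w - ℓ) y (b - ℓ) b (Or.inr rfl) ?_ (by omega) hwl ?_ (by omega) ?_
          (Or.inl ⟨hb, hbw⟩) hyb hdb
        · rintro (h | h)
          · exact hy h.1
          · omega
        · rintro (h | h)
          · exact hx2 h.1
          · omega
        · intro h
          exact hdb (dvd_of_sub ℓ _ _ _ hw5 h (by ring))
    · have key : ∀ i, 0 < i → i < ℓ → w - ℓ + i = b := by
        intro i hi1 hi2
        by_contra hne
        refine J1 (w - ℓ + i) (Or.inl ⟨hh.2.2 _ (by omega) (by omega), hne⟩) (by omega) ?_
        intro h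
        refine not_dvd_small ℓ i hi1 hi2 ?_
        exact dvd_of_add ℓ _ ℓ _ (dvd_sub h hw5) hll (by ring)
      have k1 := key 1 (by omega) (by omega)
      have k2 := key 2 (by omega) (by omega)
      omega

/-- dual bead set -/
def dual (X : ℤ → Prop) : ℤ → Prop := fun n => ¬ X (-n)

theorem ajm_dual (ℓ : ℤ) (X : ℤ → Prop) (h : AJM ℓ X) : AJM ℓ (dual X) := by
  intro z y g b hz hy hyz hdy hg hgz hdg hb hyb hdb
  unfold dual at *
  push Not at hy hg
  refine h (-y) (-z) (-b) (-g) hy hz (by omega) ?_ hb (by omega) ?_ hg (by omega) ?_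
  · convert hdy using 1; ring
  · convert hdb using 2; ring
  · convert hdg using 2; ring

theorem dual_dual (X : ℤ → Prop) : dual (dual X) = X := by
  funext n
  simp [dual]

theorem hor_dual (ℓ : ℤ) (X : ℤ → Prop) (x : ℤ) : Hor ℓ (dual X) x ↔ Ver ℓ X (ℓ - x) := by
  unfold Hor Ver dual
  have e1 : -(x - ℓ) = ℓ - x := by ring
  have e2 : ℓ - x - ℓ = -x := by ring
  rw [e1, e2, not_not]
  constructor
  · rintro ⟨a, b, c⟩
    refine ⟨b, a, fun n h1 h2 => ?_⟩
    have := c (-n) (by omega) (by omega)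
    simpa using this
  · rintro ⟨a, b, c⟩
    refine ⟨b, a, fun n h1 h2 => ?_⟩
    have := c (-n) (by omega) (by omega)
    simpa using this

theorem ver_dual (ℓ : ℤ) (X : ℤ → Prop) (x : ℤ) : Ver ℓ (dual X) x ↔ Hor ℓ X (ℓ - x) := by
  have := hor_dual ℓ (dual X) (ℓ - x)
  rw [dual_dual] at this
  rw [this]
  simp

theorem mv_dual (ℓ : ℤ) (hℓ : 0 < ℓ) (X : ℤ → Prop) (x : ℤ) (h1 : X (ℓ - x)) (h2 : ¬ X (-x)) :
    mv ℓ (dual X) x = dual (mv ℓ X (ℓ - x)) := by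
  funext n
  unfold mv dual
  apply propext
  constructor
  · rintro (⟨h, h'⟩ | rfl)
    · rintro (⟨h3, h4⟩ | h3)
      · exact h h3
      · omega
    · rintro (⟨h3, h4⟩ | h3)
      · exact h4 (by omega)
      · omega
  · intro h
    by_cases e : n = x - ℓ
    · exact Or.inr e
    · left
      constructor
      · intro h3
        exact h (Or.inl ⟨h3, by omega⟩)
      · rintro rfl
        exact h (Or.inr (by omega))

theorem key (ℓ : ℤ) (hℓ : 2 < ℓ) (X : ℤ → Prop) (h1 : AC1 ℓ X) (hC : ∀ x, ¬ PatC ℓ X x)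
    (hB : ∀ x, ¬ PatB ℓ X x)
    (hm : ∀ x, Hor ℓ X x ∨ Ver ℓ X x → AJM ℓ (mv ℓ X x)) : AJM ℓ X := by
  by_cases hex : ∃ x, X x ∧ ¬ X (x - ℓ)
  · obtain ⟨x, hx1, hx2⟩ := hex
    rcases h1 x hx1 hx2 with h | h
    · exact keyH ℓ hℓ X h1 hC hm x h
    · rw [← dual_dual X]
      apply ajm_dual
      apply keyH ℓ hℓ (dual X) ?_ ?_ ?_ (ℓ - x)
      · rw [hor_dual]; simpa using h
      · intro w hw1 hw2
        rw [hor_dual, ver_dual]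
        unfold dual at hw1 hw2
        push Not at hw2
        refine (h1 (ℓ - w) ?_ ?_).symm
        · convert hw2 using 1; ring
        · convert hw1 using 2; ring
      · rintro w ⟨hw1, hw2, hw3⟩
        rw [hor_dual] at hw1
        unfold dual at hw2 hw3
        push Not at hw2
        refine hB (ℓ - w) ⟨hw1, ?_, ?_⟩
        · convert hw2 using 1; ring
        · intro n hn1 hn2
          have := hw3 (-n) (by omega) (by omega)
          simpa using this
      · intro w hw
        rw [hor_dual, ver_dual] at hw
        have e : ℓ - w - ℓ = -w := by ring
        have a1 : X (ℓ - w) := by rcases hw with h | h <;> exact h.1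
        have a2 : ¬ X (-w) := by rw [← e]; rcases hw with h | h <;> exact h.2.1
        rw [mv_dual ℓ (by omega) X w a1 a2]
        exact ajm_dual ℓ _ (hm _ hw.symm)
  · intro z y g b hz hy hyz hdy _ _ _ _ _ _
    obtain ⟨w, hw1, hw2, _⟩ := chain' ℓ (by omega) X y z hy hz hyz hdy
    exact hex ⟨w, hw1, hw2⟩

/-! Direction JM → generalized. -/

theorem ajm_ac1 (ℓ : ℤ) (X : ℤ → Prop) (h : AJM ℓ X) : AC1 ℓ X := by
  intro x hx1 hx2
  by_contra hc
  have hh : ∃ n, x - ℓ < n ∧ n < x ∧ X n := by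
    by_contra h'
    push Not at h'
    exact hc (Or.inl ⟨hx1, hx2, h'⟩)
  have hv : ∃ n, x - ℓ < n ∧ n < x ∧ ¬ X n := by
    by_contra h'
    push Not at h'
    exact hc (Or.inr ⟨hx1, hx2, h'⟩)
  obtain ⟨b, hb1, hb2, hb3⟩ := hh
  obtain ⟨g, hg1, hg2, hg3⟩ := hv
  exact h x (x - ℓ) g b hx1 hx2 (by omega) (by simp) hg3 hg2
    (not_dvd_small ℓ _ (by omega) (by omega)) hb3 hb1
    (not_dvd_small ℓ _ (by omega) (by omega))

theorem ajm_mv (ℓ : ℤ) (hℓ : 0 < ℓ) (X : ℤ → Prop) (h : AJM ℓ X) (x : ℤ) (hx1 : X x)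
    (hx2 : ¬ X (x - ℓ)) : AJM ℓ (mv ℓ X x) := by
  intro z y g b hz hy hyz hdy hg hgz hdg hb hyb hdb
  have hll : ℓ ∣ ℓ := dvd_rfl
  -- beads / gaps of the moved set
  have hy' : ¬ X y ∨ y = x := by
    by_contra hc
    push Not at hc
    exact hy (Or.inl hc)
  have hg' : ¬ X g ∨ g = x := by
    by_contra hc
    push Not at hc
    exact hg (Or.inl hc)
  have hyn : y ≠ x - ℓ := fun e => hy (Or.inr e)
  have hgn : g ≠ x - ℓ := fun e => hg (Or.inr e)
  by_cases hzx : ℓ ∣ z - x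
  · have hgX : ¬ X g := by
      rcases hg' with h' | rfl
      · exact h'
      · exact absurd hzx hdg
    have hbX : X b := by
      rcases hb with h' | rfl
      · exact h'.1
      · exact absurd (dvd_of_sub ℓ _ _ _ (dvd_of_sub ℓ _ _ (x - y) hdy hzx (by ring)) hll
          (by ring)) hdb
    obtain ⟨z', hz'1, hz'2, hz'3⟩ : ∃ z', X z' ∧ z ≤ z' ∧ ℓ ∣ z' - z := by
      rcases hz with h' | rfl
      · exact ⟨z, h'.1, le_rfl, by simp⟩
      · exact ⟨x, hx1, by omega, by simp⟩
    obtain ⟨y', hy'1, hy'2, hy'3⟩ : ∃ y', ¬ X y' ∧ y' ≤ y ∧ ℓ ∣ y - y' := by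
      rcases hy' with h' | rfl
      · exact ⟨y, h', le_rfl, by simp⟩
      · exact ⟨y - ℓ, hx2, by omega, by simp⟩
    refine h z' y' g b hz'1 hy'1 (by omega) ?_ hgX (by omega) ?_ hbX (by omega) ?_
    · exact dvd_of_add ℓ _ _ _ hz'3 (dvd_add hdy hy'3) (by ring)
    · intro h'
      exact hdg (dvd_of_sub ℓ _ _ _ h' hz'3 (by ring))
    · intro h'
      exact hdb (dvd_of_sub ℓ _ _ _ h' hy'3 (by ring))
  · have hzX : X z := by
      rcases hz with h' | rfl
      · exact h'.1
      · exact absurd ((dvd_neg.mpr hll).trans (by simp)) hzx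
    have hyX : ¬ X y := by
      rcases hy' with h' | rfl
      · exact h'
      · exact absurd hdy hzx
    obtain ⟨g', hg1, hg2, hg3⟩ : ∃ g', ¬ X g' ∧ g' < z ∧ ¬ ℓ ∣ z - g' := by
      rcases hg' with h' | rfl
      · exact ⟨g, h', hgz, hdg⟩
      · exact ⟨g - ℓ, hx2, by omega, fun h' => hdg (dvd_of_sub ℓ _ _ _ h' hll (by ring))⟩
    obtain ⟨b', hb1, hb2, hb3⟩ : ∃ b', X b' ∧ y < b' ∧ ¬ ℓ ∣ b' - y := by
      rcases hb with h' | rfl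
      · exact ⟨b, h'.1, hyb, hdb⟩
      · exact ⟨x, hx1, by omega, fun h' => hdb (dvd_of_sub ℓ _ _ _ h' hll (by ring))⟩
    exact h z y g' b' hzX hyX hyz hdy hg1 hg2 hg3 hb1 hb2 hb3

/-- Condition (2) at the level of beads. -/
theorem ajm_c2_vh (ℓ : ℤ) (hℓ : 2 < ℓ) (X : ℤ → Prop) (h : AJM ℓ X) (x z : ℤ)
    (hx : Ver ℓ X x) (hz : Hor ℓ (mv ℓ X x) z) (h1 : x - ℓ ≤ z) (h2 : z ≤ x + ℓ) : False := by
  obtain ⟨a1, a2, a3⟩ := hx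
  obtain ⟨b1, b2, b3⟩ := hz
  have hxl : mv ℓ X x (x - ℓ) := Or.inr rfl
  have hx0 : ¬ mv ℓ X x x := by
    rintro (h | h)
    · exact h.2 rfl
    · omega
  have hzx : z ≠ x := by
    rintro rfl
    exact hx0 b1
  have hbet : ∀ n, x - ℓ ≤ n → n < x → mv ℓ X x n := by
    intro n hn1 hn2
    by_cases e : n = x - ℓ
    · exact Or.inr e
    · exact Or.inl ⟨a3 n (by omega) hn2, by omega⟩
  have hcase : z = x - ℓ ∨ z = x + ℓ := by
    by_contra hc
    push Not at hc
    by_cases hlt : z < x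
    · exact b3 (x - ℓ) (by omega) (by omega) hxl
    · exact b2 (hbet _ (by omega) (by omega))
  rcases hcase with rfl | rfl
  · have c1 : ∀ n, x - ℓ - ℓ ≤ n → n < x - ℓ → ¬ X n := by
      intro n hn1 hn2 hX
      by_cases e : n = x - ℓ - ℓ
      · subst e
        exact b2 (Or.inl ⟨hX, by omega⟩)
      · exact b3 n (by omega) hn2 (Or.inl ⟨hX, by omega⟩)
    exact h x (x - ℓ - ℓ) (x - ℓ - 1) (x - 1) a1 (c1 _ le_rfl (by omega)) (by omega)
      ⟨2, by ring⟩ (c1 _ (by omega) (by omega)) (by omega)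
      (fun h' => not_dvd_small ℓ 1 (by omega) (by omega)
        (dvd_of_sub ℓ _ ℓ _ h' dvd_rfl (by ring)))
      (a3 _ (by omega) (by omega)) (by omega)
      (fun h' => not_dvd_small ℓ 1 (by omega) (by omega)
        (dvd_of_sub ℓ (ℓ * 2) _ _ ⟨2, rfl⟩ h' (by ring)))
  · have hX : X (x + ℓ) := by
      rcases b1 with h' | h'
      · exact h'.1
      · omega
    refine h (x + ℓ) (x - ℓ) (x + 1) (x - 1) hX a2 (by omega) ⟨2, by ring⟩ ?_ (by omega) ?_
      (a3 _ (by omega) (by omega)) (by omega) ?_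
    · intro h'
      exact b3 (x + 1) (by omega) (by omega) (Or.inl ⟨h', by omega⟩)
    · exact not_dvd_small ℓ _ (by omega) (by omega)
    · exact not_dvd_small ℓ _ (by omega) (by omega)

theorem ajm_c2_hv (ℓ : ℤ) (hℓ : 2 < ℓ) (X : ℤ → Prop) (h : AJM ℓ X) (x z : ℤ)
    (hx : Hor ℓ X x) (hz : Ver ℓ (mv ℓ X x) z) (h1 : x - ℓ ≤ z) (h2 : z ≤ x + ℓ) : False := by
  have hx' : Ver ℓ (dual X) (ℓ - x) := by rw [ver_dual]; simpa using hx
  have e := mv_dual ℓ (by omega) X (ℓ - x) (by simpa using hx.1)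
    (by have := hx.2.1; convert this using 2; ring)
  rw [show ℓ - (ℓ - x) = x by ring] at e
  have hz' : Hor ℓ (mv ℓ (dual X) (ℓ - x)) (ℓ - z) := by
    rw [e, hor_dual]; simpa using hz
  exact ajm_c2_vh ℓ hℓ (dual X) (ajm_dual ℓ X h) (ℓ - x) (ℓ - z) hx' hz' (by omega) (by omega)

end Maya

/-! ### From partitions to beads -/

namespace YPartition

theorem card_down (P : ℕ → Prop) (hP : ∀ i j, 1 ≤ i → i ≤ j → P j → P i)
    (hN : ∃ N, ∀ i, N ≤ i → ¬ P i) (a : ℕ) (ha : 1 ≤ a) :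
    a ≤ Nat.card {i : ℕ | 1 ≤ i ∧ P i} ↔ P a := by
  obtain ⟨N, hN⟩ := hN
  have hk : ∃ k, ∀ i, 1 ≤ i → (P i ↔ i ≤ k) := by
    clear ha
    induction N with
    | zero => exact ⟨0, fun i hi => ⟨fun h => absurd h (hN i (by omega)), fun h => by omega⟩⟩
    | succ N ih =>
      by_cases h : 1 ≤ N ∧ P N
      · refine ⟨N, fun i hi => ⟨fun hp => ?_, fun hle => hP i N hi hle h.2⟩⟩
        by_contra hc
        exact hN i (by omega) hp
      · by_cases h0 : 1 ≤ N
        · apply ih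
          intro i hi hp
          exact h ⟨h0, hP N i h0 hi hp⟩
        · exact ⟨0, fun i hi => ⟨fun hp => absurd hp (hN i (by omega)), fun h => by omega⟩⟩
  obtain ⟨k, hk⟩ := hk
  have e : {i : ℕ | 1 ≤ i ∧ P i} = Set.Icc 1 k := by
    ext i
    simp only [Set.mem_setOf_eq, Set.mem_Icc]
    constructor
    · rintro ⟨h1, h2⟩
      exact ⟨h1, (hk i h1).1 h2⟩
    · rintro ⟨h1, h2⟩
      exact ⟨h1, (hk i h1).2 h2⟩
  rw [e, hk a ha]
  simp

theorem le_colLen (μ : YPartition) (a b : ℕ) (ha : 1 ≤ a) (hb : 1 ≤ b) :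
    a ≤ μ.colLen b ↔ b ≤ μ.part a := by
  unfold colLen
  refine card_down (fun i => b ≤ μ.part i) ?_ ?_ a ha
  · intro i j hi hij h
    exact le_trans h (μ.antitone i j hi hij)
  · obtain ⟨N, hN⟩ := μ.eventually_zero
    exact ⟨N, fun i hi h => by rw [hN i hi] at h; omega⟩

/-- The number of beads at positions `≥ n`. -/
def dg (μ : YPartition) (n : ℤ) : ℕ :=
  Nat.card {i : ℕ | 1 ≤ i ∧ n ≤ (μ.part i : ℤ) - i}

theorem le_dg (μ : YPartition) (n : ℤ) (a : ℕ) (ha : 1 ≤ a) :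
    a ≤ μ.dg n ↔ n ≤ (μ.part a : ℤ) - a := by
  unfold dg
  refine card_down (fun i => n ≤ (μ.part i : ℤ) - i) ?_ ?_ a ha
  · intro i j hi hij h
    have := μ.antitone i j hi hij
    omega
  · obtain ⟨N, hN⟩ := μ.eventually_zero
    refine ⟨N + (-n).toNat + 1, fun i hi h => ?_⟩
    rw [hN i (by omega)] at h
    omega

/-- bead predicate -/
def bead (μ : YPartition) (n : ℤ) : Prop := μ.dg (n + 1) < μ.dg n

theorem dg_le (μ : YPartition) (n : ℤ) : μ.dg (n + 1) ≤ μ.dg n := by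
  by_cases h : 1 ≤ μ.dg (n + 1)
  · rw [le_dg μ n _ h]
    have := (le_dg μ (n + 1) _ h).1 le_rfl
    omega
  · omega

theorem dg_le' (μ : YPartition) (n : ℤ) : μ.dg n ≤ μ.dg (n + 1) + 1 := by
  by_contra hc
  push Not at hc
  have h1 := (le_dg μ n (μ.dg (n + 1) + 2) (by omega)).1 (by omega)
  have h2 : ¬ (μ.dg (n + 1) + 1 ≤ μ.dg (n + 1)) := by omega
  rw [le_dg μ (n + 1) _ (by omega)] at h2
  have := μ.antitone (μ.dg (n + 1) + 1) (μ.dg (n + 1) + 2) (by omega) (by omega)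
  push_cast at *
  omega

theorem dg_anti (μ : YPartition) (m n : ℤ) (h : m ≤ n) : μ.dg n ≤ μ.dg m := by
  obtain ⟨k, hk⟩ := Int.eq_ofNat_of_zero_le (sub_nonneg.2 h)
  have : n = m + k := by omega
  subst this
  clear h hk
  induction k with
  | zero => simp
  | succ k ih =>
    have := μ.dg_le (m + k)
    rw [show m + (k : ℤ) + 1 = m + ((k + 1 : ℕ) : ℤ) by push_cast; ring] at this
    omega

theorem dg_add_nonneg (μ : YPartition) (n : ℤ) : 0 ≤ (μ.dg n : ℤ) + n := by
  by_cases h : 0 ≤ n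
  · omega
  · have := (le_dg μ n (-n).toNat (by omega)).2 (by omega)
    omega

theorem dg_add_mono (μ : YPartition) (m n : ℤ) (h : m ≤ n) :
    (μ.dg m : ℤ) + m ≤ μ.dg n + n := by
  obtain ⟨k, hk⟩ := Int.eq_ofNat_of_zero_le (sub_nonneg.2 h)
  have : n = m + k := by omega
  subst this
  clear h hk
  induction k with
  | zero => simp
  | succ k ih =>
    have := μ.dg_le' (m + k)
    rw [show m + (k : ℤ) + 1 = m + ((k + 1 : ℕ) : ℤ) by push_cast; ring] at this
    push_cast at *
    omega

theorem mem_cells (μ : YPartition) (a b : ℕ) :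
    (a, b) ∈ μ.cells ↔ 1 ≤ a ∧ 1 ≤ b ∧ a ≤ μ.dg ((b : ℤ) - a) := by
  unfold cells
  simp only [Set.mem_setOf_eq]
  constructor
  · rintro ⟨h1, h2, h3⟩
    refine ⟨h1, h2, ?_⟩
    rw [le_dg _ _ _ h1]
    omega
  · rintro ⟨h1, h2, h3⟩
    refine ⟨h1, h2, ?_⟩
    rw [le_dg _ _ _ h1] at h3
    omega

theorem cells_down (μ : YPartition) (a b c d : ℕ) (h : (a, b) ∈ μ.cells) (hc : 1 ≤ c)
    (hd : 1 ≤ d) (hca : c ≤ a) (hdb : d ≤ b) : (c, d) ∈ μ.cells := by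
  obtain ⟨h1, h2, h3⟩ := h
  have := μ.antitone c a hc hca
  refine ⟨hc, hd, ?_⟩
  dsimp only at *
  omega

theorem bead_row (μ : YPartition) (z : ℤ) (h : μ.bead z) :
    1 ≤ μ.dg z ∧ (μ.part (μ.dg z) : ℤ) - μ.dg z = z := by
  unfold bead at h
  have h1 : 1 ≤ μ.dg z := by omega
  refine ⟨h1, ?_⟩
  have h2 := (le_dg μ z _ h1).1 le_rfl
  have h3 : ¬ (μ.dg z ≤ μ.dg (z + 1)) := by omega
  rw [le_dg μ _ _ h1] at h3
  omega

theorem gap_col (μ : YPartition) (y : ℤ) (h : ¬ μ.bead y) :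
    ∃ b : ℕ, 1 ≤ b ∧ (b : ℤ) - 1 - μ.colLen b = y := by
  unfold bead at h
  have h0 := μ.dg_le y
  have hn := μ.dg_add_nonneg y
  obtain ⟨b, hb⟩ := Int.eq_ofNat_of_zero_le hn
  refine ⟨b + 1, by omega, ?_⟩
  have h1 : μ.dg y ≤ μ.colLen (b + 1) := by
    by_cases h' : 1 ≤ μ.dg y
    · rw [le_colLen _ _ _ h' (by omega)]
      have := (le_dg μ (y + 1) (μ.dg y) h').1 (by omega)
      omega
    · omega
  have h2 : ¬ (μ.dg y + 1 ≤ μ.colLen (b + 1)) := by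
    rw [le_colLen _ _ _ (by omega) (by omega)]
    have : ¬ (μ.dg y + 1 ≤ μ.dg y) := by omega
    rw [le_dg μ _ _ (by omega)] at this
    push_cast at *
    omega
  push_cast
  omega

theorem row_bead (μ : YPartition) (a : ℕ) (ha : 1 ≤ a) : μ.bead ((μ.part a : ℤ) - a) := by
  unfold bead
  have h1 := (le_dg μ ((μ.part a : ℤ) - a) a ha).2 le_rfl
  have h2 : ¬ (a ≤ μ.dg ((μ.part a : ℤ) - a + 1)) := by
    rw [le_dg _ _ _ ha]; omega
  omega

theorem col_gap (μ : YPartition) (b : ℕ) (hb : 1 ≤ b) :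
    ¬ μ.bead ((b : ℤ) - 1 - μ.colLen b) := by
  unfold bead
  set c := μ.colLen b with hc
  set n : ℤ := (b : ℤ) - 1 - c with hn
  have h1 : c ≤ μ.dg (n + 1) := by
    by_cases h : 1 ≤ c
    · rw [le_dg _ _ _ h]
      have := (le_colLen μ c b h hb).1 le_rfl
      omega
    · omega
  have h2 : ¬ (c + 1 ≤ μ.dg n) := by
    rw [le_dg _ _ _ (by omega)]
    have : ¬ (c + 1 ≤ μ.colLen b) := by omega
    rw [le_colLen μ _ b (by omega) hb] at this
    push_cast
    omega
  omega

theorem cell_iff (μ : YPartition) (a b : ℕ) (ha : 1 ≤ a) (hb : 1 ≤ b) :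
    (a, b) ∈ μ.cells ↔ (b : ℤ) - 1 - μ.colLen b < (μ.part a : ℤ) - a := by
  have := le_colLen μ a b ha hb
  unfold cells
  simp only [Set.mem_setOf_eq]
  constructor
  · rintro ⟨_, _, h⟩
    have := this.2 h
    omega
  · intro h
    refine ⟨ha, hb, ?_⟩
    by_contra hc
    have h2 : ¬ a ≤ μ.colLen b := fun h => hc (this.1 h)
    omega

theorem hook_eq (μ : YPartition) (a b : ℕ) (h : (a, b) ∈ μ.cells) :
    (μ.hook a b : ℤ) = ((μ.part a : ℤ) - a) - ((b : ℤ) - 1 - μ.colLen b) := by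
  obtain ⟨h1, h2, h3⟩ := h
  dsimp only at *
  have := (le_colLen μ a b h1 h2).2 h3
  unfold hook
  omega

theorem jm_iff (ℓ : ℕ) (μ : YPartition) : IsJM ℓ μ ↔ Maya.AJM ℓ μ.bead := by
  constructor
  · intro h z y g b hz hy hyz hdy hg hgz hdg hb hyb hdb
    obtain ⟨r1, r2⟩ := bead_row μ z hz
    obtain ⟨s1, s2⟩ := bead_row μ b hb
    obtain ⟨c, c1, c2⟩ := gap_col μ y hy
    obtain ⟨d, d1, d2⟩ := gap_col μ g hg
    have m1 : (μ.dg z, c) ∈ μ.cells := (cell_iff _ _ _ r1 c1).2 (by omega)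
    have m2 : (μ.dg z, d) ∈ μ.cells := (cell_iff _ _ _ r1 d1).2 (by omega)
    have m3 : (μ.dg b, c) ∈ μ.cells := (cell_iff _ _ _ s1 c1).2 (by omega)
    refine h ⟨μ.dg z, c, d, μ.dg b, m1, m2, m3, ?_, ?_, ?_⟩
    · rw [← Int.natCast_dvd_natCast, hook_eq _ _ _ m1, r2, c2]; exact hdy
    · rw [← Int.natCast_dvd_natCast, hook_eq _ _ _ m2, r2, d2]; exact hdg
    · rw [← Int.natCast_dvd_natCast, hook_eq _ _ _ m3, s2, c2]; exact hdb
  · rintro h ⟨a, b, y, x, m1, m2, m3, h1, h2, h3⟩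
    rw [← Int.natCast_dvd_natCast, hook_eq _ _ _ m1] at h1
    rw [← Int.natCast_dvd_natCast, hook_eq _ _ _ m2] at h2
    rw [← Int.natCast_dvd_natCast, hook_eq _ _ _ m3] at h3
    have ha : 1 ≤ a := m1.1
    have hb : 1 ≤ b := m1.2.1
    have hy : 1 ≤ y := m2.2.1
    have hx : 1 ≤ x := m3.1
    exact h _ _ _ _ (row_bead μ a ha) (col_gap μ b hb) ((cell_iff _ _ _ ha hb).1 m1) h1
      (col_gap μ y hy) ((cell_iff _ _ _ ha hy).1 m2) h2
      (row_bead μ x hx) ((cell_iff _ _ _ hx hb).1 m3) h3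

/-- The rim hook attached to the bead `x`. -/
def hk (ℓ : ℕ) (μ : YPartition) (x : ℤ) : Set (ℕ × ℕ) :=
  {p | p.1 = μ.dg ((p.2 : ℤ) - p.1) ∧ x - ℓ < (p.2 : ℤ) - p.1 ∧ (p.2 : ℤ) - p.1 ≤ x}

/-- The cell of `hk` of content `n`. -/
def rc (μ : YPartition) (n : ℤ) : ℕ × ℕ := (μ.dg n, ((μ.dg n : ℤ) + n).toNat)

theorem rc_content (μ : YPartition) (n : ℤ) : ((μ.rc n).2 : ℤ) - (μ.rc n).1 = n := by
  have := μ.dg_add_nonneg n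
  unfold rc
  dsimp only
  omega

theorem rc_mem (ℓ : ℕ) (μ : YPartition) (x n : ℤ) (h1 : x - ℓ < n) (h2 : n ≤ x) :
    μ.rc n ∈ hk ℓ μ x := by
  have := rc_content μ n
  refine ⟨?_, by omega, by omega⟩
  rw [this]
  rfl

theorem hk_eq_rc (ℓ : ℕ) (μ : YPartition) (x : ℤ) (p : ℕ × ℕ) (hp : p ∈ hk ℓ μ x) :
    p = μ.rc ((p.2 : ℤ) - p.1) := by
  obtain ⟨h1, h2, h3⟩ := hp
  unfold rc
  rw [← h1]
  ext
  · rfl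
  · simp

theorem hk_subset (ℓ : ℕ) (μ : YPartition) (x : ℤ) (hx : μ.bead x) (hy : ¬ μ.bead (x - ℓ)) :
    hk ℓ μ x ⊆ μ.cells := by
  rintro ⟨a, b⟩ ⟨h1, h2, h3⟩
  dsimp only at *
  rw [mem_cells]
  unfold bead at hx hy
  have := μ.dg_anti _ _ h3
  have h4 := μ.dg_add_mono (x - ℓ + 1) _ (by omega : x - ℓ + 1 ≤ (b : ℤ) - a)
  have h5 := μ.dg_add_nonneg (x - ℓ)
  have h6 := μ.dg_le (x - ℓ)
  refine ⟨by omega, by omega, by omega⟩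

theorem hor_iff (ℓ : ℕ) (hℓ : 0 < ℓ) (μ : YPartition) (x : ℤ) (hx : μ.bead x)
    (hy : ¬ μ.bead (x - ℓ)) : HorizontalHook (hk ℓ μ x) ↔ Maya.Hor ℓ μ.bead x := by
  constructor
  · rintro ⟨a, ha⟩
    refine ⟨hx, hy, fun n h1 h2 => ?_⟩
    have e1 := ha _ (rc_mem ℓ μ x n h1 (by omega))
    have e2 := ha _ (rc_mem ℓ μ x (n + 1) (by omega) (by omega))
    unfold bead
    unfold rc at e1 e2
    dsimp only at *
    omega
  · rintro ⟨_, _, h⟩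
    have key : ∀ k : ℕ, (k : ℤ) < ℓ → μ.dg (x - k) = μ.dg x := by
      intro k
      induction k with
      | zero => simp
      | succ k ih =>
        intro hk
        have := h (x - (k + 1 : ℕ)) (by omega) (by omega)
        unfold bead at this
        have h2 := μ.dg_le (x - (k + 1 : ℕ))
        rw [show x - ((k + 1 : ℕ) : ℤ) + 1 = x - k by push_cast; ring] at this h2
        have := ih (by omega)
        omega
    refine ⟨μ.dg x, ?_⟩
    rintro ⟨a, b⟩ ⟨h1, h2, h3⟩
    dsimp only at *
    have := key (x - (b - a)).toNat (by omega)
    rw [show x - (((x - ((b : ℤ) - a)).toNat : ℕ) : ℤ) = (b : ℤ) - a by omega] at this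
    omega

theorem ver_iff (ℓ : ℕ) (hℓ : 0 < ℓ) (μ : YPartition) (x : ℤ) (hx : μ.bead x)
    (hy : ¬ μ.bead (x - ℓ)) : VerticalHook (hk ℓ μ x) ↔ Maya.Ver ℓ μ.bead x := by
  constructor
  · rintro ⟨a, ha⟩
    refine ⟨hx, hy, fun n h1 h2 => ?_⟩
    have e1 := ha _ (rc_mem ℓ μ x n h1 (by omega))
    have e2 := ha _ (rc_mem ℓ μ x (n + 1) (by omega) (by omega))
    have c1 := rc_content μ n
    have c2 := rc_content μ (n + 1)
    unfold bead
    have e3 : (μ.rc n).1 = μ.dg n := rfl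
    have e4 : (μ.rc (n + 1)).1 = μ.dg (n + 1) := rfl
    omega
  · rintro ⟨_, _, h⟩
    have key : ∀ k : ℕ, (k : ℤ) < ℓ → μ.dg (x - k) = μ.dg x + k := by
      intro k
      induction k with
      | zero => simp
      | succ k ih =>
        intro hk
        have := h (x - (k + 1 : ℕ)) (by omega) (by omega)
        unfold bead at this
        have h2 := μ.dg_le' (x - (k + 1 : ℕ))
        rw [show x - ((k + 1 : ℕ) : ℤ) + 1 = x - k by push_cast; ring] at this h2
        have := ih (by omega)
        omega
    refine ⟨((μ.dg x : ℤ) + x).toNat, ?_⟩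
    rintro ⟨a, b⟩ ⟨h1, h2, h3⟩
    dsimp only at *
    have := key (x - (b - a)).toNat (by omega)
    rw [show x - (((x - ((b : ℤ) - a)).toNat : ℕ) : ℤ) = (b : ℤ) - a by omega] at this
    omega

/-- Removing `hk` moves a bead. -/
theorem dg_remove (ℓ : ℕ) (μ ν : YPartition) (x : ℤ) (hx : μ.bead x) (hy : ¬ μ.bead (x - ℓ))
    (hν : ν.cells = μ.cells \ hk ℓ μ x) (n : ℤ) :
    μ.dg n = ν.dg n + if x - ℓ < n ∧ n ≤ x then 1 else 0 := by
  -- membership on diagonal n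
  have hmem : ∀ a : ℕ, 1 ≤ a → 1 ≤ (a : ℤ) + n →
      (a ≤ ν.dg n ↔ a ≤ μ.dg n ∧ ¬ (a = μ.dg n ∧ x - ℓ < n ∧ n ≤ x)) := by
    intro a ha hb
    have hc : (((a : ℤ) + n).toNat : ℤ) - a = n := by omega
    have e : (a, ((a : ℤ) + n).toNat) ∈ ν.cells ↔
        (a, ((a : ℤ) + n).toNat) ∈ μ.cells \ hk ℓ μ x := by rw [hν]
    rw [Set.mem_diff, mem_cells, mem_cells] at e
    unfold hk at e
    simp only [Set.mem_setOf_eq] at e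
    rw [hc] at e
    have hb' : 1 ≤ ((a : ℤ) + n).toNat := by omega
    simpa [ha, hb'] using e
  have hμ0 := μ.dg_add_nonneg n
  have hν0 := ν.dg_add_nonneg n
  have hin : x - ℓ < n ∧ n ≤ x → 1 ≤ μ.dg n ∧ 1 ≤ (μ.dg n : ℤ) + n := by
    rintro ⟨h1, h2⟩
    have hs := hk_subset ℓ μ x hx hy (rc_mem ℓ μ x n h1 h2)
    have c := rc_content μ n
    have e : (μ.rc n).1 = μ.dg n := rfl
    have a1 : 1 ≤ (μ.rc n).1 := hs.1
    have a2 : 1 ≤ (μ.rc n).2 := hs.2.1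
    omega
  by_cases hI : x - ℓ < n ∧ n ≤ x
  · rw [if_pos hI]
    obtain ⟨i1, i2⟩ := hin hI
    have t1 := hmem (μ.dg n) i1 i2
    have u1 : ¬ μ.dg n ≤ ν.dg n := fun h => (t1.1 h).2 ⟨rfl, hI⟩
    by_cases h2 : 1 ≤ μ.dg n - 1 ∧ 1 ≤ ((μ.dg n - 1 : ℕ) : ℤ) + n
    · have := (hmem (μ.dg n - 1) h2.1 h2.2).2 ⟨by omega, fun h => by omega⟩
      omega
    · omega
  · rw [if_neg hI]
    have g1 : μ.dg n ≤ ν.dg n := by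
      by_cases h2 : 1 ≤ μ.dg n ∧ 1 ≤ (μ.dg n : ℤ) + n
      · exact (hmem _ h2.1 h2.2).2 ⟨le_rfl, fun h => hI h.2⟩
      · omega
    have g2 : ν.dg n ≤ μ.dg n := by
      by_cases h2 : 1 ≤ ν.dg n ∧ 1 ≤ (ν.dg n : ℤ) + n
      · exact ((hmem _ h2.1 h2.2).1 le_rfl).1
      · omega
    omega

theorem bead_remove (ℓ : ℕ) (hℓ : 0 < ℓ) (μ ν : YPartition) (x : ℤ) (hx : μ.bead x)
    (hy : ¬ μ.bead (x - ℓ)) (hν : ν.cells = μ.cells \ hk ℓ μ x) :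
    ν.bead = Maya.mv ℓ μ.bead x := by
  funext n
  apply propext
  have h1 := dg_remove ℓ μ ν x hx hy hν n
  have h2 := dg_remove ℓ μ ν x hx hy hν (n + 1)
  have h3 := μ.dg_le n
  have h4 := μ.dg_le' n
  have h5 := ν.dg_le n
  have h6 := ν.dg_le' n
  unfold Maya.mv
  by_cases e1 : n = x
  · subst e1
    unfold bead at *
    rw [if_pos (by omega)] at h1
    rw [if_neg (by omega)] at h2
    constructor
    · intro h; omega
    · rintro (h | h)
      · exact absurd rfl h.2
      · omega
  · by_cases e2 : n = x - ℓ
    · subst e2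
      unfold bead at *
      rw [if_neg (by omega)] at h1
      rw [if_pos (by omega)] at h2
      constructor
      · intro h; exact Or.inr rfl
      · intro _; omega
    · have : (ν.bead n ↔ μ.bead n) := by
        unfold bead
        by_cases hI : x - ℓ < n ∧ n ≤ x
        · rw [if_pos hI] at h1
          rw [if_pos (by omega)] at h2
          omega
        · rw [if_neg hI] at h1
          rw [if_neg (by omega)] at h2
          omega
      rw [this]
      simp [e1, e2]

theorem cells_finite (μ : YPartition) : μ.cells.Finite := by
  obtain ⟨N, hN⟩ := μ.eventually_zero
  apply ((Set.finite_Iic N).prod (Set.finite_Iic (μ.part 1))).subset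
  rintro ⟨a, b⟩ ⟨h1, h2, h3⟩
  dsimp only at *
  refine ⟨?_, ?_⟩
  · simp only [Set.mem_Iic]
    by_contra h
    have := hN a (by omega)
    omega
  · simp only [Set.mem_Iic]
    exact le_trans h3 (μ.antitone 1 a le_rfl h1)

theorem exists_of_down (μ : YPartition) (T : Set (ℕ × ℕ)) (hT : T ⊆ μ.cells)
    (hd : ∀ a b c d, (a, b) ∈ T → 1 ≤ c → 1 ≤ d → c ≤ a → d ≤ b → (c, d) ∈ T) :
    ∃ ν : YPartition, ν.cells = T := by
  classical
  have hspec : ∀ a b, 1 ≤ b → ((a, b) ∈ T ↔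
      b ≤ Nat.findGreatest (fun b => (a, b) ∈ T) (μ.part a)) := by
    intro a b hb
    constructor
    · intro h
      exact Nat.le_findGreatest (hT h).2.2 h
    · intro h
      have h0 : Nat.findGreatest (fun b => (a, b) ∈ T) (μ.part a) ≠ 0 := by omega
      have := Nat.findGreatest_of_ne_zero rfl h0
      exact hd _ _ _ _ this (hT this).1 hb le_rfl h
  refine ⟨⟨fun a => Nat.findGreatest (fun b => (a, b) ∈ T) (μ.part a), ?_, ?_, ?_⟩, ?_⟩
  · rw [μ.zero_at_zero]; simp
  · intro i j hi hij
    by_cases h : 1 ≤ Nat.findGreatest (fun b => (j, b) ∈ T) (μ.part j)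
    · rw [← hspec i _ h]
      exact hd _ _ _ _ ((hspec j _ h).2 le_rfl) hi h hij le_rfl
    · omega
  · obtain ⟨N, hN⟩ := μ.eventually_zero
    refine ⟨N, fun i hi => ?_⟩
    rw [hN i hi]; simp
  · ext ⟨a, b⟩
    unfold cells
    simp only [Set.mem_setOf_eq]
    constructor
    · rintro ⟨h1, h2, h3⟩
      exact (hspec a b h2).2 h3
    · intro h
      exact ⟨(hT h).1, (hT h).2.1, (hspec a b (hT h).2.1).1 h⟩

theorem rc_adj (μ : YPartition) (n : ℤ) : BoxAdjacent (μ.rc n) (μ.rc (n + 1)) := by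
  have h1 := rc_content μ n
  have h2 := rc_content μ (n + 1)
  have h3 : (μ.rc n).1 = μ.dg n := rfl
  have h4 : (μ.rc (n + 1)).1 = μ.dg (n + 1) := rfl
  have h5 := μ.dg_le n
  have h6 := μ.dg_le' n
  unfold BoxAdjacent
  omega

theorem boxAdj_symm {p q : ℕ × ℕ} (h : BoxAdjacent p q) : BoxAdjacent q p := by
  unfold BoxAdjacent at *
  omega

theorem hk_conn (ℓ : ℕ) (μ : YPartition) (x : ℤ) : SetConnected (hk ℓ μ x) := by
  have up : ∀ (k : ℕ) (m : ℤ), x - ℓ < m → m + k ≤ x →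
      Relation.ReflTransGen (fun p q => p ∈ hk ℓ μ x ∧ q ∈ hk ℓ μ x ∧ BoxAdjacent p q)
        (μ.rc m) (μ.rc (m + k)) ∧
      Relation.ReflTransGen (fun p q => p ∈ hk ℓ μ x ∧ q ∈ hk ℓ μ x ∧ BoxAdjacent p q)
        (μ.rc (m + k)) (μ.rc m) := by
    intro k m hm
    induction k with
    | zero =>
      intro _
      simp only [Nat.cast_zero, add_zero]
      exact ⟨.refl, .refl⟩
    | succ k ih =>
      intro hk'
      push_cast at hk'
      obtain ⟨i1, i2⟩ := ih (by omega)
      have a := rc_mem ℓ μ x (m + k) (by omega) (by omega)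
      have b := rc_mem ℓ μ x (m + k + 1) (by omega) (by omega)
      have c := rc_adj μ (m + k)
      rw [show m + ((k + 1 : ℕ) : ℤ) = m + k + 1 by push_cast; ring]
      exact ⟨i1.tail ⟨a, b, c⟩, i2.head ⟨b, a, boxAdj_symm c⟩⟩
  intro p hp q hq
  rw [hk_eq_rc ℓ μ x p hp, hk_eq_rc ℓ μ x q hq]
  obtain ⟨_, p2, p3⟩ := hp
  obtain ⟨_, q2, q3⟩ := hq
  set m : ℤ := (p.2 : ℤ) - p.1
  set n : ℤ := (q.2 : ℤ) - q.1
  rcases le_total m n with h | h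
  · have := (up (n - m).toNat m p2 (by omega)).1
    rwa [show m + ((n - m).toNat : ℤ) = n by omega] at this
  · have := (up (m - n).toNat n q2 (by omega)).2
    rwa [show n + ((m - n).toNat : ℤ) = m by omega] at this

theorem ncard_of_contents (S : Set (ℕ × ℕ)) (C : Set ℤ) (f : ℤ → ℕ × ℕ)
    (hf : ∀ n, ((f n).2 : ℤ) - (f n).1 = n) (h : S = f '' C) : S.ncard = C.ncard := by
  rw [h]
  apply Set.ncard_image_of_injective
  intro a b hab
  rw [← hf a, ← hf b, hab]

theorem hk_eq_image (ℓ : ℕ) (μ : YPartition) (x : ℤ) :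
    hk ℓ μ x = μ.rc '' Set.Ioc (x - ℓ) x := by
  ext p
  constructor
  · intro hp
    exact ⟨_, ⟨hp.2.1, hp.2.2⟩, (hk_eq_rc ℓ μ x p hp).symm⟩
  · rintro ⟨n, ⟨h1, h2⟩, rfl⟩
    exact rc_mem ℓ μ x n h1 h2

theorem hk_ncard (ℓ : ℕ) (μ : YPartition) (x : ℤ) : (hk ℓ μ x).ncard = ℓ := by
  rw [ncard_of_contents _ _ μ.rc (rc_content μ) (hk_eq_image ℓ μ x)]
  rw [Set.ncard_eq_toFinset_card']
  simp

theorem hk_rimHook (ℓ : ℕ) (μ : YPartition) (x : ℤ) (hx : μ.bead x)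
    (hy : ¬ μ.bead (x - ℓ)) : IsRimHook ℓ μ (hk ℓ μ x) := by
  refine ⟨hk_subset ℓ μ x hx hy, hk_ncard ℓ μ x, hk_conn ℓ μ x, ?_, ?_⟩
  · rintro ⟨a, b, h1, _, _, h4⟩
    have e1 := h1.1
    have e2 := h4.1
    dsimp only at *
    rw [show ((b + 1 : ℕ) : ℤ) - ((a + 1 : ℕ) : ℤ) = b - a by push_cast; ring] at e2
    omega
  · apply exists_of_down μ _ Set.diff_subset
    rintro a b c d ⟨h1, h2⟩ hc hd hca hdb
    refine ⟨cells_down μ a b c d h1 hc hd hca hdb, ?_⟩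
    rintro ⟨h3, h4, h5⟩
    dsimp only at *
    rw [mem_cells] at h1
    obtain ⟨a1, b1, h1⟩ := h1
    apply h2
    unfold bead at hx hy
    -- content of (a,b) versus (c,d)
    by_cases hlow : x - ℓ < (b : ℤ) - a
    · by_cases hup : (b : ℤ) - a ≤ x
      · refine ⟨?_, hlow, hup⟩
        dsimp only
        rcases le_total ((b : ℤ) - a) ((d : ℤ) - c) with h | h
        · have := μ.dg_add_mono _ _ h
          omega
        · have := μ.dg_anti _ _ h
          omega
      · exfalso
        have e1 := μ.dg_anti (x + 1) ((b : ℤ) - a) (by omega)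
        have e2 := μ.dg_anti _ _ h5
        omega
    · exfalso
      have e1 := μ.dg_add_mono ((b : ℤ) - a) (x - ℓ) (by omega)
      have e2 := μ.dg_add_mono (x - ℓ + 1) ((d : ℤ) - c) (by omega)
      have e3 := μ.dg_le (x - ℓ)
      omega

theorem conn_contents (S : Set (ℕ × ℕ)) (p q : ℕ × ℕ) (hp : p ∈ S)
    (h : Relation.ReflTransGen (fun x y => x ∈ S ∧ y ∈ S ∧ BoxAdjacent x y) p q) (n : ℤ)
    (h1 : (p.2 : ℤ) - p.1 ≤ n) (h2 : n ≤ (q.2 : ℤ) - q.1) :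
    ∃ s ∈ S, (s.2 : ℤ) - s.1 = n := by
  induction h with
  | refl => exact ⟨p, hp, by omega⟩
  | @tail b c _ hbc ih =>
    obtain ⟨hb, hc, hadj⟩ := hbc
    by_cases h3 : n ≤ (b.2 : ℤ) - b.1
    · exact ih h3
    · refine ⟨c, hc, ?_⟩
      unfold BoxAdjacent at hadj
      omega

theorem rimHook_eq (ℓ : ℕ) (hℓ : 0 < ℓ) (μ : YPartition) (S : Set (ℕ × ℕ))
    (h : IsRimHook ℓ μ S) : ∃ x, μ.bead x ∧ ¬ μ.bead (x - ℓ) ∧ S = hk ℓ μ x := by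
  obtain ⟨hsub, hcard, hconn, hsq, ν, hν⟩ := h
  have hS : ∀ a b, (a, b) ∈ S ↔ 1 ≤ a ∧ 1 ≤ b ∧ ν.dg ((b : ℤ) - a) < a ∧
      a ≤ μ.dg ((b : ℤ) - a) := by
    intro a b
    have e : (a, b) ∈ ν.cells ↔ (a, b) ∈ μ.cells \ S := by rw [hν]
    rw [Set.mem_diff] at e
    constructor
    · intro hs
      have hm := hsub hs
      have hn : ¬ (a, b) ∈ ν.cells := fun h => (e.1 h).2 hs
      rw [mem_cells] at hm hn
      refine ⟨hm.1, hm.2.1, ?_, hm.2.2⟩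
      by_contra hc
      exact hn ⟨hm.1, hm.2.1, not_lt.1 hc⟩
    · rintro ⟨h1, h2, h3, h4⟩
      by_contra hc
      have := e.2 ⟨(mem_cells _ _ _).2 ⟨h1, h2, h4⟩, hc⟩
      rw [mem_cells] at this
      omega
  have hle : ∀ n, ν.dg n ≤ μ.dg n := by
    intro n
    have hν0 := ν.dg_add_nonneg n
    have hμ0 := μ.dg_add_nonneg n
    by_cases h2 : 1 ≤ ν.dg n ∧ 1 ≤ (ν.dg n : ℤ) + n
    · have hm : ν.rc n ∈ ν.cells := by
        have c := rc_content ν n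
        have e : (ν.rc n).1 = ν.dg n := rfl
        have := (mem_cells ν (ν.rc n).1 (ν.rc n).2).2 ⟨by omega, by omega, by rw [c, e]⟩
        exact this
      rw [hν] at hm
      have := (mem_cells μ (ν.rc n).1 (ν.rc n).2).1 hm.1
      rw [rc_content] at this
      exact this.2.2
    · omega
  have hle1 : ∀ n, μ.dg n ≤ ν.dg n + 1 := by
    intro n
    by_contra hc
    push Not at hc
    have hν0 := ν.dg_add_nonneg n
    set a := ν.dg n + 1 with ha
    obtain ⟨b, hb⟩ := Int.eq_ofNat_of_zero_le (by omega : 0 ≤ (a : ℤ) + n)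
    have hn1 : (b : ℤ) - a = n := by omega
    have hn2 : ((b + 1 : ℕ) : ℤ) - ((a + 1 : ℕ) : ℤ) = n := by push_cast; omega
    have s1 : (a, b) ∈ S := by
      rw [hS, hn1]; omega
    have s2 : (a + 1, b + 1) ∈ S := by
      rw [hS, hn2]; omega
    have hb1 : 1 ≤ b := by omega
    have hnot : (a, b) ∉ ν.cells := by rw [hν]; exact fun h => h.2 s1
    have mid : ∀ c d, a ≤ c → b ≤ d → c ≤ a + 1 → d ≤ b + 1 → (c, d) ∈ S := by
      intro c d h1 h2 h3 h4
      by_contra hs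
      have hm := cells_down μ (a + 1) (b + 1) c d (hsub s2) (by omega) (by omega) h3 h4
      have : (c, d) ∈ ν.cells := by rw [hν]; exact ⟨hm, hs⟩
      exact hnot (cells_down ν c d a b this (by omega) hb1 h1 h2)
    exact hsq ⟨a, b, s1, mid _ _ (by omega) (by omega) (by omega) (by omega),
      mid _ _ (by omega) (by omega) (by omega) (by omega), s2⟩
  set C : Set ℤ := {n | ν.dg n < μ.dg n} with hC
  have hSC : S = μ.rc '' C := by
    ext p
    obtain ⟨a, b⟩ := p
    constructor
    · intro hp
      obtain ⟨h1, h2, h3, h4⟩ := (hS a b).1 hp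
      have h5 := hle1 ((b : ℤ) - a)
      refine ⟨(b : ℤ) - a, by simp only [hC, Set.mem_setOf_eq]; omega, ?_⟩
      have : μ.dg ((b : ℤ) - a) = a := by omega
      unfold rc
      rw [this]
      simp
    · rintro ⟨n, hn, e⟩
      have hn' : ν.dg n < μ.dg n := hn
      have hν0 := ν.dg_add_nonneg n
      have c := rc_content μ n
      rw [e] at c
      have e1 : μ.dg n = a := congrArg Prod.fst e
      dsimp only at c
      rw [hS, c]
      omega
  have hCcard : C.ncard = ℓ := by
    rw [← hcard, ncard_of_contents S C μ.rc (rc_content μ) hSC]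
  have hCfin : C.Finite := Set.finite_of_ncard_pos (by omega)
  have hCne : C.Nonempty := Set.nonempty_of_ncard_ne_zero (by omega)
  have hCmem : ∀ p ∈ S, (p.2 : ℤ) - p.1 ∈ C := by
    intro p hp
    rw [hSC] at hp
    obtain ⟨n, hn, rfl⟩ := hp
    rw [rc_content]; exact hn
  have hCS : ∀ n ∈ C, μ.rc n ∈ S := by
    intro n hn
    rw [hSC]; exact ⟨n, hn, rfl⟩
  obtain ⟨x, hxC, hxmax⟩ := Set.exists_max_image C id hCfin hCne
  obtain ⟨m, hmC, hmmin⟩ := Set.exists_min_image C id hCfin hCne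
  simp only [id] at hxmax hmmin
  have hCI : C = Set.Icc m x := by
    ext n
    constructor
    · intro hn
      exact ⟨hmmin n hn, hxmax n hn⟩
    · rintro ⟨h1, h2⟩
      obtain ⟨s, hs, e⟩ := conn_contents S (μ.rc m) (μ.rc x) (hCS m hmC)
        (hconn _ (hCS m hmC) _ (hCS x hxC)) n (by rw [rc_content]; exact h1)
        (by rw [rc_content]; exact h2)
      rw [← e]
      exact hCmem s hs
  have hml : m = x - ℓ + 1 := by
    rw [hCI, Set.ncard_eq_toFinset_card'] at hCcard
    simp at hCcard
    have := hmmin x hxC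
    omega
  have hmem : ∀ n, n ∈ C ↔ x - ℓ < n ∧ n ≤ x := by
    intro n
    rw [hCI, Set.mem_Icc]
    omega
  have hmem' : ∀ n, ν.dg n < μ.dg n ↔ x - ℓ < n ∧ n ≤ x := hmem
  refine ⟨x, ?_, ?_, ?_⟩
  · unfold bead
    have a1 := (hmem' x).2 (by omega)
    have a2 := (hmem' (x + 1)).not.2 (by omega)
    have a3 := hle (x + 1)
    have a4 := ν.dg_le x
    omega
  · unfold bead
    have a1 := (hmem' (x - ℓ + 1)).2 (by omega)
    have a2 := (hmem' (x - ℓ)).not.2 (by omega)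
    have a3 := hle (x - ℓ)
    have a4 := ν.dg_le' (x - ℓ)
    omega
  · rw [hSC, hk_eq_image, hCI]
    congr 1
    ext n
    simp only [Set.mem_Icc, Set.mem_Ioc]
    omega

theorem adj_hk (ℓ : ℕ) (μ ν : YPartition) (x z : ℤ)
    (h : SetsAdjacent (hk ℓ μ x) (hk ℓ ν z)) : x - ℓ ≤ z ∧ z ≤ x + ℓ := by
  obtain ⟨p, hp, q, hq, hadj⟩ := h
  obtain ⟨_, p2, p3⟩ := hp
  obtain ⟨_, q2, q3⟩ := hq
  unfold BoxAdjacent at hadj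
  omega

theorem jm_cond1 (ℓ : ℕ) (hℓ : 2 < ℓ) (μ : YPartition) (h : Maya.AJM ℓ μ.bead) :
    Cond1 ℓ μ := by
  intro S hS
  obtain ⟨x, hx, hy, rfl⟩ := rimHook_eq ℓ (by omega) μ S hS
  rw [hor_iff ℓ (by omega) μ x hx hy, ver_iff ℓ (by omega) μ x hx hy]
  exact Maya.ajm_ac1 ℓ _ h x hx hy

theorem jm_cond2 (ℓ : ℕ) (hℓ : 2 < ℓ) (μ : YPartition) (h : Maya.AJM ℓ μ.bead) :
    Cond2 ℓ μ := by
  rintro ⟨R, S, ν, hR, hν, hS, hadj, hvh⟩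
  obtain ⟨x, hx, hy, rfl⟩ := rimHook_eq ℓ (by omega) μ R hR
  obtain ⟨z, hz, hw, rfl⟩ := rimHook_eq ℓ (by omega) ν S hS
  rw [hor_iff ℓ (by omega) μ x hx hy, ver_iff ℓ (by omega) μ x hx hy,
    hor_iff ℓ (by omega) ν z hz hw, ver_iff ℓ (by omega) ν z hz hw,
    bead_remove ℓ (by omega) μ ν x hx hy hν] at hvh
  obtain ⟨a1, a2⟩ := adj_hk ℓ μ ν x z hadj
  rcases hvh with ⟨h1, h2⟩ | ⟨h1, h2⟩
  · exact Maya.ajm_c2_vh ℓ (by omega) _ h x z h1 h2 a1 a2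
  · exact Maya.ajm_c2_hv ℓ (by omega) _ h x z h1 h2 a1 a2

theorem jm_gen (ℓ : ℕ) (hℓ : 2 < ℓ) (lam : YPartition) (h : Maya.AJM ℓ lam.bead) :
    IsGenLPartition ℓ lam := by
  intro mu hmu
  have : Maya.AJM ℓ mu.bead := by
    induction hmu with
    | refl => exact h
    | tail _ hstep ih =>
      obtain ⟨S, hS, _, hc⟩ := hstep
      obtain ⟨x, hx, hy, rfl⟩ := rimHook_eq ℓ (by omega) _ S hS
      rw [bead_remove ℓ (by omega) _ _ x hx hy hc]
      exact Maya.ajm_mv ℓ (by omega) _ ih x hx hy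
  exact ⟨jm_cond1 ℓ hℓ mu this, jm_cond2 ℓ hℓ mu this⟩

theorem gen_jm (ℓ : ℕ) (hℓ : 2 < ℓ) : ∀ (N : ℕ) (lam : YPartition), lam.cells.ncard ≤ N →
    IsGenLPartition ℓ lam → Maya.AJM ℓ lam.bead := by
  intro N
  induction N with
  | zero =>
    intro lam hN _
    -- no beads can move, treated uniformly below: no cells
    have he : lam.cells = ∅ := by
      rw [← Set.ncard_eq_zero lam.cells_finite]; omega
    rw [← jm_iff]
    rintro ⟨a, b, y, x, h, _⟩
    rw [he] at h
    exact h
  | succ N ih =>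
    intro lam hN hgen
    obtain ⟨hc1, hc2⟩ := hgen lam .refl
    have step : ∀ x, lam.bead x → ¬ lam.bead (x - ℓ) →
        ∃ ν : YPartition, ν.cells = lam.cells \ hk ℓ lam x ∧
          ν.bead = Maya.mv ℓ lam.bead x := by
      intro x hx hy
      obtain ⟨ν, hν⟩ := (hk_rimHook ℓ lam x hx hy).2.2.2.2
      exact ⟨ν, hν, bead_remove ℓ (by omega) lam ν x hx hy hν⟩
    apply Maya.key ℓ (by omega)
    · intro x hx hy
      rw [← hor_iff ℓ (by omega) lam x hx hy, ← ver_iff ℓ (by omega) lam x hx hy]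
      exact hc1 _ (hk_rimHook ℓ lam x hx hy)
    · rintro x ⟨hH, h2, h3⟩
      have hx := hH.1
      have hy := hH.2.1
      obtain ⟨ν, hν, hb⟩ := step x hx hy
      have hV : Maya.Ver ℓ ν.bead (x - ℓ) := by
        rw [hb]
        refine ⟨Or.inr rfl, ?_, fun n hn1 hn2 => Or.inl ⟨h3 n hn1 hn2, by omega⟩⟩
        rintro (h | h)
        · exact h2 h.1
        · omega
      refine hc2 ⟨hk ℓ lam x, hk ℓ ν (x - ℓ), ν, hk_rimHook ℓ lam x hx hy, hν,
        hk_rimHook ℓ ν _ hV.1 hV.2.1, ?_, Or.inr ⟨(hor_iff ℓ (by omega) lam x hx hy).2 hH,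
          (ver_iff ℓ (by omega) ν _ hV.1 hV.2.1).2 hV⟩⟩
      refine ⟨lam.rc (x - ℓ + 1), rc_mem ℓ lam x _ (by omega) (by omega),
        ν.rc (x - ℓ), rc_mem ℓ ν _ _ (by omega) (by omega), ?_⟩
      have e := dg_remove ℓ lam ν x hx hy hν (x - ℓ)
      rw [if_neg (by omega)] at e
      have : ν.rc (x - ℓ) = lam.rc (x - ℓ) := by
        unfold rc; rw [e]; rfl
      rw [this]
      exact boxAdj_symm (rc_adj lam _)
    · rintro x ⟨hV, h2, h3⟩
      have hx := hV.1
      have hy := hV.2.1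
      obtain ⟨ν, hν, hb⟩ := step x hx hy
      have hH : Maya.Hor ℓ ν.bead (x + ℓ) := by
        rw [hb]
        refine ⟨Or.inl ⟨h2, by omega⟩, ?_, fun n hn1 hn2 => ?_⟩
        · rintro (h | h)
          · exact h.2 (by ring)
          · omega
        · rintro (h | h)
          · exact h3 n (by omega) hn2 h.1
          · omega
      refine hc2 ⟨hk ℓ lam x, hk ℓ ν (x + ℓ), ν, hk_rimHook ℓ lam x hx hy, hν,
        hk_rimHook ℓ ν _ hH.1 hH.2.1, ?_, Or.inl ⟨(ver_iff ℓ (by omega) lam x hx hy).2 hV,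
          (hor_iff ℓ (by omega) ν _ hH.1 hH.2.1).2 hH⟩⟩
      refine ⟨lam.rc x, rc_mem ℓ lam x _ (by omega) (by omega),
        ν.rc (x + 1), rc_mem ℓ ν _ _ (by omega) (by omega), ?_⟩
      have e := dg_remove ℓ lam ν x hx hy hν (x + 1)
      rw [if_neg (by omega)] at e
      have : ν.rc (x + 1) = lam.rc (x + 1) := by
        unfold rc; rw [e]; rfl
      rw [this]
      exact rc_adj lam _
    · intro x hxx
      have hx : lam.bead x := by rcases hxx with h | h <;> exact h.1
      have hy : ¬ lam.bead (x - ℓ) := by rcases hxx with h | h <;> exact h.2.1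
      obtain ⟨ν, hν, hb⟩ := step x hx hy
      rw [← hb]
      have hrim := hk_rimHook ℓ lam x hx hy
      apply ih
      · have := Set.ncard_diff_add_ncard_of_subset hrim.1 lam.cells_finite
        rw [← hν, hk_ncard] at this
        omega
      · intro mu hmu
        refine hgen mu (Relation.ReflTransGen.head ⟨hk ℓ lam x, hrim, ?_, hν⟩ hmu)
        rw [hor_iff ℓ (by omega) lam x hx hy, ver_iff ℓ (by omega) lam x hx hy]
        exact hxx

end YPartition


open YPartition
/-- A partition is an `(ℓ,0)`-JM partition iff it is a generalized
`ℓ`-partition. -/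
theorem statement2 (ℓ : ℕ) (hℓ : 2 < ℓ) (lam : YPartition) :
    IsJM ℓ lam ↔ IsGenLPartition ℓ lam := by
  rw [YPartition.jm_iff]
  exact ⟨YPartition.jm_gen ℓ hℓ lam, YPartition.gen_jm ℓ hℓ _ lam le_rfl⟩
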